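/- arXiv:1808.08218 — 11 statements merged into one kernel-verified Lean document; each statement's English description precedes it below -/
import Mathlib

section
/- Let γ ≠ 1 be a real number. Given two Euler states (ρ₋, v₁₋, v₂₋, v₃₋, β₋) and (ρ₊, v₁₊, v₂₊, v₃₊, β₊) with ρ₋, ρ₊ > 0 and β₋, β₊ > 0, define the vector U^# ∈ ℝ⁵ by U^#₁ = ρˡⁿ, U^#₂ = ρˡⁿ·{v₁}, U^#₃ = ρˡⁿ·{v₂}, U^#₄ = ρˡⁿ·{v₃}, and U^#₅ = ρˡⁿ/(2βˡⁿ(γ−1)) + ρˡⁿ·({v₁}² + {v₂}² + {v₃}² − ½({v₁²} + {v₂²} + {v₃²})). Then the discrete entropy conservation condition in time holds: ⟦w⟧ · U^# = ⟦Φ⟧ = ρ₊ − ρ₋, where w and Φ are the entropy variables and entropy potential evaluated at the two states. -/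
open Matrix

/-- Logarithmic mean of two positive reals: `(a₊ − a₋)/(ln a₊ − ln a₋)` if `a₊ ≠ a₋`,
and `a₋` otherwise. -/
noncomputable def logMean (am ap : ℝ) : ℝ :=
  if ap = am then am else (ap - am) / (Real.log ap - Real.log am)

/-- Entropy variables for the compressible Euler equations with adiabatic constant `γ`,
for a state `(ρ, v₁, v₂, v₃, β)`, where `ς = −(γ−1)·ln ρ − ln β − ln 2`. -/
noncomputable def eulerW (γ ρ v1 v2 v3 β : ℝ) : Fin 5 → ℝ :=
  ![(γ - (-(γ - 1) * Real.log ρ - Real.log β - Real.log 2)) / (γ - 1)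
      - β * (v1 ^ 2 + v2 ^ 2 + v3 ^ 2),
    2 * β * v1, 2 * β * v2, 2 * β * v3, -(2 * β)]

theorem logMean_pos_mul {a b : ℝ} (ha : 0 < a) (hb : 0 < b) :
    logMean a b ≠ 0 ∧ (Real.log b - Real.log a) * logMean a b = b - a := by
  unfold logMean
  split_ifs with h
  · subst h
    exact ⟨ha.ne', by ring⟩
  · have h1 : Real.log b - Real.log a ≠ 0 := fun h2 =>
      h (Real.log_injOn_pos hb ha (sub_eq_zero.mp h2))
    have h3 : b - a ≠ 0 := sub_ne_zero.mpr h
    exact ⟨div_ne_zero h3 h1, by field_simp⟩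

/-- The entropy conservative temporal Euler state `U^#` satisfies the discrete entropy
conservation condition in time `⟦w⟧ · U^# = ⟦Φ⟧ = ρ₊ − ρ₋`. -/
theorem euler_temporal_state_entropy_conservative
    (γ ρm v1m v2m v3m βm ρp v1p v2p v3p βp : ℝ)
    (hγ : γ ≠ 1) (hρm : 0 < ρm) (hρp : 0 < ρp) (hβm : 0 < βm) (hβp : 0 < βp) :
    (eulerW γ ρp v1p v2p v3p βp - eulerW γ ρm v1m v2m v3m βm) ⬝ᵥ
      ![logMean ρm ρp,
        logMean ρm ρp * ((v1p + v1m) / 2),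
        logMean ρm ρp * ((v2p + v2m) / 2),
        logMean ρm ρp * ((v3p + v3m) / 2),
        logMean ρm ρp / (2 * logMean βm βp * (γ - 1))
          + logMean ρm ρp *
            (((v1p + v1m) / 2) ^ 2 + ((v2p + v2m) / 2) ^ 2 + ((v3p + v3m) / 2) ^ 2
              - (1 / 2) * ((v1p ^ 2 + v1m ^ 2) / 2 + (v2p ^ 2 + v2m ^ 2) / 2
                + (v3p ^ 2 + v3m ^ 2) / 2))] = ρp - ρm := by
  obtain ⟨-, hR⟩ := logMean_pos_mul hρm hρp
  obtain ⟨hB0, hB⟩ := logMean_pos_mul hβm hβp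
  have hg : γ - 1 ≠ 0 := sub_ne_zero.mpr hγ
  generalize logMean ρm ρp = R at *
  generalize logMean βm βp = B at *
  simp only [eulerW, dotProduct, Fin.sum_univ_five, Pi.sub_apply]
  simp
  have hb : βp = βm + (Real.log βp - Real.log βm) * B := by linarith
  rw [← hR]
  generalize Real.log βp = x at *
  generalize Real.log βm = y at *
  subst hb
  field_simp
  ring
end

section
/- Let γ > 1 be a real number. Given two Euler states (ρ₋, v₁₋, v₂₋, v₃₋, β₋) and (ρ₊, v₁₊, v₂₊, v₃₊, β₊) with ρ₋, ρ₊ > 0 and β₋, β₊ > 0, the upwind temporal state U* := u₋ = (ρ₋, ρ₋v₁₋, ρ₋v₂₋, ρ₋v₃₋, E₋) with E₋ := ρ₋/(2β₋(γ−1)) + (ρ₋/2)(v₁₋² + v₂₋² + v₃₋²) satisfies the entropy stability condition in time: ⟦w⟧ · U* ≤ ⟦Φ⟧ = ρ₊ − ρ₋, where w and Φ are the entropy variables and entropy potential evaluated at the two states. -/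
open Matrix

/-- The upwind temporal state `U* = u₋` for the compressible Euler equations satisfies the
entropy stability condition in time `⟦w⟧ · U* ≤ ⟦Φ⟧ = ρ₊ − ρ₋`. -/
theorem euler_upwind_temporal_state_entropy_stable
    (γ ρm v1m v2m v3m βm ρp v1p v2p v3p βp : ℝ)
    (hγ : 1 < γ) (hρm : 0 < ρm) (hρp : 0 < ρp) (hβm : 0 < βm) (hβp : 0 < βp) :
    (eulerW γ ρp v1p v2p v3p βp - eulerW γ ρm v1m v2m v3m βm) ⬝ᵥ
      ![ρm, ρm * v1m, ρm * v2m, ρm * v3m,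
        ρm / (2 * βm * (γ - 1)) + ρm / 2 * (v1m ^ 2 + v2m ^ 2 + v3m ^ 2)]
      ≤ ρp - ρm := by
  have hg : 0 < γ - 1 := by linarith
  have key : ∀ a b : ℝ, 0 < a → 0 < b → Real.log b - Real.log a ≤ (b - a) / a := by
    intro a b ha hb
    have h := Real.log_le_sub_one_of_pos (div_pos hb ha)
    rw [Real.log_div hb.ne' ha.ne'] at h
    rw [sub_div, div_self ha.ne']
    exact h
  have h1 : ρm * (Real.log ρp - Real.log ρm) ≤ ρp - ρm := by
    have h := mul_le_mul_of_nonneg_left (key ρm ρp hρm hρp) hρm.le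
    rwa [mul_div_cancel₀ _ hρm.ne'] at h
  have h2 : 0 ≤ ρm / (γ - 1) * ((βp - βm) / βm - (Real.log βp - Real.log βm)) :=
    mul_nonneg (by positivity) (sub_nonneg.2 (key βm βp hβm hβp))
  have h3 : 0 ≤ ρm * βp * ((v1p - v1m) ^ 2 + (v2p - v2m) ^ 2 + (v3p - v3m) ^ 2) := by
    positivity
  have e : (eulerW γ ρp v1p v2p v3p βp - eulerW γ ρm v1m v2m v3m βm) ⬝ᵥ
      ![ρm, ρm * v1m, ρm * v2m, ρm * v3m,
        ρm / (2 * βm * (γ - 1)) + ρm / 2 * (v1m ^ 2 + v2m ^ 2 + v3m ^ 2)]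
      = ρm * (Real.log ρp - Real.log ρm)
        - ρm / (γ - 1) * ((βp - βm) / βm - (Real.log βp - Real.log βm))
        - ρm * βp * ((v1p - v1m) ^ 2 + (v2p - v2m) ^ 2 + (v3p - v3m) ^ 2) := by
    have hg' := hg.ne'
    simp [eulerW, dotProduct, Fin.sum_univ_succ]
    field_simp
    ring
  rw [e]
  linarith
end

section
/- Given two shallow water states (h₋, v₁₋, v₂₋) and (h₊, v₁₊, v₂₊) with gravitational constant g ≥ 0 and h₋ ≥ 0, the upwind temporal state U* := (h₋, h₋v₁₋, h₋v₂₋) ∈ ℝ³ satisfies the entropy stability condition in time: ⟦w⟧ · U* ≤ g·{h}·⟦h⟧ = ⟦Φ⟧, where w and Φ are the entropy variables and entropy potential evaluated at the two states. -/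
open Matrix

/-- Entropy variables for the shallow water equations with gravitational constant `g`,
for a state `(h, v₁, v₂)`. -/
noncomputable def swW (g h v1 v2 : ℝ) : Fin 3 → ℝ :=
  ![g * h - (1 / 2) * (v1 ^ 2 + v2 ^ 2), v1, v2]

/-- The upwind temporal state `U* = (h₋, h₋v₁₋, h₋v₂₋)` for the shallow water equations
satisfies the entropy stability condition in time `⟦w⟧ · U* ≤ g·{h}·⟦h⟧ = ⟦Φ⟧`. -/
theorem shallow_water_upwind_temporal_state_entropy_stable
    (g hm v1m v2m hp v1p v2p : ℝ) (hg : 0 ≤ g) (hhm : 0 ≤ hm) :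
    ((swW g hp v1p v2p - swW g hm v1m v2m) ⬝ᵥ ![hm, hm * v1m, hm * v2m]
      ≤ g * ((hp + hm) / 2) * (hp - hm))
    ∧ g * ((hp + hm) / 2) * (hp - hm) = g * hp ^ 2 / 2 - g * hm ^ 2 / 2 := by
  refine ⟨?_, by ring⟩
  simp only [swW, dotProduct, Fin.sum_univ_three, Pi.sub_apply, Matrix.cons_val]
  have h1 := mul_nonneg hg (sq_nonneg (hp - hm))
  have h2 := mul_nonneg hhm (sq_nonneg (v1p - v1m))
  have h3 := mul_nonneg hhm (sq_nonneg (v2p - v2m))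
  nlinarith [h1, h2, h3]
end

section
/- Let γ ≠ 1 be a real number. Given two ideal MHD states (ρ±, v₁±, v₂±, v₃±, β±, B₁±, B₂±, B₃±) with ρ₋, ρ₊ > 0 and β₋, β₊ > 0, define U^# ∈ ℝ⁸ by U^#₁ = ρˡⁿ, U^#₂ = ρˡⁿ{v₁}, U^#₃ = ρˡⁿ{v₂}, U^#₄ = ρˡⁿ{v₃}, U^#₅ = ρˡⁿ/(2βˡⁿ(γ−1)) + ρˡⁿ({v₁}² + {v₂}² + {v₃}² − ½({v₁²} + {v₂²} + {v₃²})) + {B₁}² + {B₂}² + {B₃}² − ½({B₁²} + {B₂²} + {B₃²}), U^#₆ = {B₁}, U^#₇ = {B₂}, U^#₈ = {B₃}. Then the discrete entropy conservation condition in time holds: ⟦w⟧ · U^# = ⟦ρ + β(B₁² + B₂² + B₃²)⟧, where w is the vector of entropy variables evaluated at the two states. -/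
open Matrix

/-- Entropy variables for the ideal MHD equations with adiabatic constant `γ`,
for a state `(ρ, v₁, v₂, v₃, β, B₁, B₂, B₃)`, where `ς = −(γ−1)·ln ρ − ln β − ln 2`. -/
noncomputable def mhdW (γ ρ v1 v2 v3 β B1 B2 B3 : ℝ) : Fin 8 → ℝ :=
  ![(γ - (-(γ - 1) * Real.log ρ - Real.log β - Real.log 2)) / (γ - 1)
      - β * (v1 ^ 2 + v2 ^ 2 + v3 ^ 2),
    2 * β * v1, 2 * β * v2, 2 * β * v3, -(2 * β),
    2 * β * B1, 2 * β * B2, 2 * β * B3]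

theorem logMean_mul (a b : ℝ) (ha : 0 < a) (hb : 0 < b) :
    logMean a b * (Real.log b - Real.log a) = b - a := by
  unfold logMean
  split_ifs with h
  · subst h; simp
  · have : Real.log b - Real.log a ≠ 0 := fun h' =>
      h (Real.log_injOn_pos hb ha (sub_eq_zero.mp h'))
    field_simp

theorem logMean_ne_zero (a b : ℝ) (ha : 0 < a) (hb : 0 < b) : logMean a b ≠ 0 := by
  by_cases h : b = a
  · simp [logMean, h, ha.ne']
  · intro h0
    have := logMean_mul a b ha hb
    rw [h0, zero_mul] at this
    exact h (by linarith)

/-- The entropy conservative temporal state `U^#` for the ideal MHD equations satisfies the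
discrete entropy conservation condition in time `⟦w⟧ · U^# = ⟦ρ + β(B₁² + B₂² + B₃²)⟧`. -/
theorem mhd_temporal_state_entropy_conservative
    (γ ρm v1m v2m v3m βm B1m B2m B3m ρp v1p v2p v3p βp B1p B2p B3p : ℝ)
    (hγ : γ ≠ 1) (hρm : 0 < ρm) (hρp : 0 < ρp) (hβm : 0 < βm) (hβp : 0 < βp) :
    (mhdW γ ρp v1p v2p v3p βp B1p B2p B3p - mhdW γ ρm v1m v2m v3m βm B1m B2m B3m) ⬝ᵥ
      ![logMean ρm ρp,
        logMean ρm ρp * ((v1p + v1m) / 2),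
        logMean ρm ρp * ((v2p + v2m) / 2),
        logMean ρm ρp * ((v3p + v3m) / 2),
        logMean ρm ρp / (2 * logMean βm βp * (γ - 1))
          + logMean ρm ρp *
            (((v1p + v1m) / 2) ^ 2 + ((v2p + v2m) / 2) ^ 2 + ((v3p + v3m) / 2) ^ 2
              - (1 / 2) * ((v1p ^ 2 + v1m ^ 2) / 2 + (v2p ^ 2 + v2m ^ 2) / 2
                + (v3p ^ 2 + v3m ^ 2) / 2))
          + ((B1p + B1m) / 2) ^ 2 + ((B2p + B2m) / 2) ^ 2 + ((B3p + B3m) / 2) ^ 2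
          - (1 / 2) * ((B1p ^ 2 + B1m ^ 2) / 2 + (B2p ^ 2 + B2m ^ 2) / 2
              + (B3p ^ 2 + B3m ^ 2) / 2),
        (B1p + B1m) / 2, (B2p + B2m) / 2, (B3p + B3m) / 2]
      = (ρp + βp * (B1p ^ 2 + B2p ^ 2 + B3p ^ 2))
        - (ρm + βm * (B1m ^ 2 + B2m ^ 2 + B3m ^ 2)) := by
  have hR := logMean_mul ρm ρp hρm hρp
  have hL := logMean_mul βm βp hβm hβp
  have hL0 := logMean_ne_zero βm βp hβm hβp
  have hg : γ - 1 ≠ 0 := sub_ne_zero.mpr hγ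
  simp only [mhdW, dotProduct, Fin.sum_univ_succ, Pi.sub_apply]
  simp
  generalize logMean ρm ρp = R at *
  generalize logMean βm βp = L at *
  generalize Real.log ρm = a at *
  generalize Real.log ρp = b at *
  generalize Real.log βm = c at *
  generalize Real.log βp = d at *
  have hK : (βp - βm) * (R / (2 * L * (γ - 1))) * 2 = R * (d - c) / (γ - 1) := by
    rw [← hL]; field_simp
  have hw : ∀ x y : ℝ, (γ - (-((γ - 1) * x) - y - Real.log 2)) / (γ - 1)
      = x + y / (γ - 1) + (γ + Real.log 2) / (γ - 1) := by
    intro x y; field_simp; ring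
  have hw2 : ∀ x y : ℝ, (γ - ((1 - γ) * x - y - Real.log 2)) / (γ - 1)
      = x + y / (γ - 1) + (γ + Real.log 2) / (γ - 1) := by
    intro x y; field_simp; ring
  simp only [hw, hw2]
  linear_combination hR - hK
end

section
/- Let γ > 1 be a real number. Given two ideal MHD states (ρ±, v₁±, v₂±, v₃±, β±, B₁±, B₂±, B₃±) with ρ₋, ρ₊ > 0 and β₋, β₊ > 0, the upwind temporal state U* := (ρ₋, ρ₋v₁₋, ρ₋v₂₋, ρ₋v₃₋, E₋, B₁₋, B₂₋, B₃₋) ∈ ℝ⁸, where E₋ := ρ₋/(2β₋(γ−1)) + (ρ₋/2)(v₁₋² + v₂₋² + v₃₋²) + ½(B₁₋² + B₂₋² + B₃₋²), satisfies the entropy stability condition in time: ⟦w⟧ · U* ≤ ⟦ρ + β(B₁² + B₂² + B₃²)⟧, where w is the vector of entropy variables evaluated at the two states. -/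
open Matrix

/-- The upwind temporal state for the ideal MHD equations satisfies the entropy stability
condition in time `⟦w⟧ · U* ≤ ⟦ρ + β(B₁² + B₂² + B₃²)⟧`. -/
theorem mhd_upwind_temporal_state_entropy_stable
    (γ ρm v1m v2m v3m βm B1m B2m B3m ρp v1p v2p v3p βp B1p B2p B3p : ℝ)
    (hγ : 1 < γ) (hρm : 0 < ρm) (hρp : 0 < ρp) (hβm : 0 < βm) (hβp : 0 < βp) :
    (mhdW γ ρp v1p v2p v3p βp B1p B2p B3p - mhdW γ ρm v1m v2m v3m βm B1m B2m B3m) ⬝ᵥ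
      ![ρm, ρm * v1m, ρm * v2m, ρm * v3m,
        ρm / (2 * βm * (γ - 1)) + ρm / 2 * (v1m ^ 2 + v2m ^ 2 + v3m ^ 2)
          + (1 / 2) * (B1m ^ 2 + B2m ^ 2 + B3m ^ 2),
        B1m, B2m, B3m]
      ≤ (ρp + βp * (B1p ^ 2 + B2p ^ 2 + B3p ^ 2))
        - (ρm + βm * (B1m ^ 2 + B2m ^ 2 + B3m ^ 2)) := by
  have hg : 0 < γ - 1 := by linarith
  have h1 : 0 ≤ ρp - ρm - ρm * (Real.log ρp - Real.log ρm) := by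
    have h := Real.log_le_sub_one_of_pos (div_pos hρp hρm)
    rw [Real.log_div hρp.ne' hρm.ne'] at h
    have h' := mul_le_mul_of_nonneg_left h hρm.le
    have e : ρm * (ρp / ρm - 1) = ρp - ρm := by field_simp
    linarith
  have h2 : 0 ≤ ρm / (γ - 1) * (βp / βm - 1 - (Real.log βp - Real.log βm)) := by
    have h := Real.log_le_sub_one_of_pos (div_pos hβp hβm)
    rw [Real.log_div hβp.ne' hβm.ne'] at h
    exact mul_nonneg (div_pos hρm hg).le (by linarith)
  have h3 : 0 ≤ ρm * βp * ((v1p - v1m) ^ 2 + (v2p - v2m) ^ 2 + (v3p - v3m) ^ 2) := by positivity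
  have h4 : 0 ≤ βp * ((B1p - B1m) ^ 2 + (B2p - B2m) ^ 2 + (B3p - B3m) ^ 2) := by positivity
  rw [← sub_nonneg]
  refine (add_nonneg (add_nonneg (add_nonneg h1 h2) h3) h4).trans_eq ?_
  simp only [mhdW, dotProduct, Fin.sum_univ_eight, Pi.sub_apply]
  simp only [Matrix.cons_val]
  have hg' := hg.ne'
  have hb := hβm.ne'
  field_simp
  ring
end

section
/- Let K ≥ 1 and let Q be a summation-by-parts matrix of size (K+1)×(K+1). Then for any nodal values a₀, …, a_K and b₀, …, b_K ∈ ℝ, the identities ∑_{i,j=0}^{K} Q_{ij}·(a_i − a_j)·((b_i + b_j)/2) = ∑_{i,j=0}^{K} Q_{ij}·a_i·b_j − (a_K·b_K − a₀·b₀) and ∑_{i,j=0}^{K} Q_{ij}·(a_i − a_j)·((b_i + b_j)/2) = −∑_{i,j=0}^{K} Q_{ij}·a_j·b_i hold. -/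
open Matrix

/-- A summation-by-parts matrix of size `(K+1)×(K+1)`: every row sum vanishes and
`Q + Qᵀ = B`, where `B = diag(−1, 0, …, 0, 1)`. -/
def IsSBP {K : ℕ} (Q : Matrix (Fin (K + 1)) (Fin (K + 1)) ℝ) : Prop :=
  (∀ i, ∑ j, Q i j = 0) ∧
    Q + Qᵀ = Matrix.diagonal
      (fun i => if i = 0 then (-1 : ℝ) else if i = Fin.last K then 1 else 0)

/-- For an SBP matrix `Q`,
`∑ᵢⱼ Q_{ij}·⟦a⟧_{(i,j)}·{b}_{(i,j)} = ∑ᵢⱼ Q_{ij} aᵢ bⱼ − (a_K b_K − a₀ b₀)` and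
`∑ᵢⱼ Q_{ij}·⟦a⟧_{(i,j)}·{b}_{(i,j)} = −∑ᵢⱼ Q_{ij} aⱼ bᵢ`. -/
theorem sbp_jump_average_identities (K : ℕ) (hK : 1 ≤ K)
    (Q : Matrix (Fin (K + 1)) (Fin (K + 1)) ℝ) (hQ : IsSBP Q)
    (a b : Fin (K + 1) → ℝ) :
    (∑ i, ∑ j, Q i j * (a i - a j) * ((b i + b j) / 2)
      = (∑ i, ∑ j, Q i j * a i * b j) - (a (Fin.last K) * b (Fin.last K) - a 0 * b 0))
    ∧ ∑ i, ∑ j, Q i j * (a i - a j) * ((b i + b j) / 2)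
      = -∑ i, ∑ j, Q i j * a j * b i := by
  obtain ⟨hr, hB⟩ := hQ
  have hne : Fin.last K ≠ 0 := by
    intro h
    have := congrArg Fin.val h
    simp at this
    omega
  have key : ∀ f : Fin (K + 1) → Fin (K + 1) → ℝ,
      ∑ i, ∑ j, Q i j * f i j + ∑ i, ∑ j, Q i j * f j i
        = f (Fin.last K) (Fin.last K) - f 0 0 := by
    intro f
    have h1 : ∑ i, ∑ j, Q i j * f j i = ∑ i, ∑ j, Q j i * f i j := Finset.sum_comm
    rw [h1, ← Finset.sum_add_distrib]
    have h2 : ∀ i, (∑ j, Q i j * f i j + ∑ j, Q j i * f i j)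
        = (if i = Fin.last K then f i i else 0) - (if i = 0 then f i i else 0) := by
      intro i
      rw [← Finset.sum_add_distrib, Finset.sum_eq_single i]
      · have h := congrFun (congrFun hB i) i
        simp only [Matrix.add_apply, Matrix.transpose_apply, Matrix.diagonal_apply_eq] at h
        rw [← add_mul, h]
        by_cases h0 : i = 0
        · subst h0
          simp [hne.symm]
        · by_cases hl : i = Fin.last K <;> simp [h0, hl, hne]
      · intro j _ hj
        have h := congrFun (congrFun hB i) j
        rw [Matrix.diagonal_apply_ne _ hj.symm] at h
        simp only [Matrix.add_apply, Matrix.transpose_apply] at h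
        rw [← add_mul, h, zero_mul]
      · simp
    simp only [h2, Finset.sum_sub_distrib]
    simp
  have hz : ∑ i, ∑ j, Q i j * (a i * b i) = 0 := by
    simp [← Finset.sum_mul, hr]
  have k1 := key (fun i _ => a i * b i)
  have k2 := key (fun i j => a i * b j)
  beta_reduce at k1 k2
  have e1 : ∑ i, ∑ j, Q i j * (a i - a j) * ((b i + b j) / 2)
      = (∑ i, ∑ j, Q i j * (a i * b i) + ∑ i, ∑ j, Q i j * (a i * b j)
        - ∑ i, ∑ j, Q i j * (a j * b i) - ∑ i, ∑ j, Q i j * (a j * b j)) / 2 := by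
    simp only [← Finset.sum_add_distrib, ← Finset.sum_sub_distrib, Finset.sum_div]
    refine Finset.sum_congr rfl fun i _ => Finset.sum_congr rfl fun j _ => ?_
    ring
  rw [e1]
  simp only [mul_assoc]
  constructor <;> linarith
end

section
/- Let K ≥ 1 and let Q be a summation-by-parts matrix of size (K+1)×(K+1). Then for any nodal values a₀,…,a_K, b₀,…,b_K, c₀,…,c_K ∈ ℝ, the identity ∑_{i,j=0}^{K} Q_{ij}·(a_i − a_j)·((b_i + b_j)/2)·((c_i + c_j)/2) = −½∑_{i,j=0}^{K} Q_{ij}·a_j·b_i·c_j + ½∑_{i,j=0}^{K} Q_{ij}·a_i·b_i·c_j − ½∑_{i,j=0}^{K} Q_{ij}·a_j·b_i·c_i holds. -/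
open Matrix

theorem sbp_swap_aux {n : ℕ} (Q : Matrix (Fin n) (Fin n) ℝ) (d : Fin n → ℝ)
    (h : Q + Qᵀ = Matrix.diagonal d) (f : Fin n → Fin n → ℝ) :
    ∑ i, ∑ j, Q i j * f j i = ∑ i, d i * f i i - ∑ i, ∑ j, Q i j * f i j := by
  rw [eq_sub_iff_add_eq, Finset.sum_comm, ← Finset.sum_add_distrib]
  refine Finset.sum_congr rfl fun i _ => ?_
  rw [← Finset.sum_add_distrib]
  have h2 : ∀ j, Q j i * f i j + Q i j * f i j = if i = j then d i * f i j else 0 := by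
    intro j
    have h3 := congrFun (congrFun h i) j
    rw [Matrix.add_apply, Matrix.transpose_apply, Matrix.diagonal_apply] at h3
    rw [← add_mul, add_comm, h3]
    split_ifs <;> simp
  simp [h2]

/-- For an SBP matrix `Q`,
`∑ᵢⱼ Q_{ij}·⟦a⟧_{(i,j)}·{b}_{(i,j)}·{c}_{(i,j)}
  = −½∑ᵢⱼ Q_{ij} aⱼ bᵢ cⱼ + ½∑ᵢⱼ Q_{ij} aᵢ bᵢ cⱼ − ½∑ᵢⱼ Q_{ij} aⱼ bᵢ cᵢ`. -/
theorem sbp_jump_two_average_identity (K : ℕ) (hK : 1 ≤ K)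
    (Q : Matrix (Fin (K + 1)) (Fin (K + 1)) ℝ) (hQ : IsSBP Q)
    (a b c : Fin (K + 1) → ℝ) :
    ∑ i, ∑ j, Q i j * (a i - a j) * ((b i + b j) / 2) * ((c i + c j) / 2)
      = -(1 / 2) * ∑ i, ∑ j, Q i j * a j * b i * c j
        + (1 / 2) * ∑ i, ∑ j, Q i j * a i * b i * c j
        - (1 / 2) * ∑ i, ∑ j, Q i j * a j * b i * c i := by
  obtain ⟨h0, h⟩ := hQ
  have s1 := sbp_swap_aux Q _ h (fun i j => a j * b i * c j)
  have s2 := sbp_swap_aux Q _ h (fun i j => a j * b i * c i)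
  have s3 := sbp_swap_aux Q _ h (fun i j => a i * b i * c j)
  have s4 := sbp_swap_aux Q _ h (fun i j => a i * b i * c i)
  have z : ∑ i, ∑ j, Q i j * (a i * b i * c i) = 0 := by
    simp [← Finset.sum_mul, h0]
  have e : ∑ i, ∑ j, Q i j * (a i - a j) * ((b i + b j) / 2) * ((c i + c j) / 2)
      = (1 / 4) * (∑ i, ∑ j, Q i j * (a i * b i * c i) + ∑ i, ∑ j, Q i j * (a i * b i * c j)
        + ∑ i, ∑ j, Q i j * (a i * b j * c i) + ∑ i, ∑ j, Q i j * (a i * b j * c j)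
        - ∑ i, ∑ j, Q i j * (a j * b i * c i) - ∑ i, ∑ j, Q i j * (a j * b i * c j)
        - ∑ i, ∑ j, Q i j * (a j * b j * c i) - ∑ i, ∑ j, Q i j * (a j * b j * c j)) := by
    simp only [← Finset.sum_add_distrib, ← Finset.sum_sub_distrib, Finset.mul_sum]
    refine Finset.sum_congr rfl fun i _ => Finset.sum_congr rfl fun j _ => ?_
    ring
  rw [e]
  simp only [mul_assoc] at *
  linarith
end

section
/- Let K ≥ 1, let Q be a summation-by-parts matrix of size (K+1)×(K+1), and let p ∈ ℕ. Let U, W : {0,…,K} → ℝᵖ be nodal vectors and s, Φ : {0,…,K} → ℝ nodal scalars satisfying Φ_σ = ⟨W_σ, U_σ⟩ − s_σ for every σ. Let G : {0,…,K} × {0,…,K} → ℝᵖ be a two-point state that is symmetric (G(σ,θ) = G(θ,σ)), consistent (G(σ,σ) = U_σ), and satisfies the discrete entropy conservation condition ⟨W_σ − W_θ, G(σ,θ)⟩ = Φ_σ − Φ_θ for all σ, θ. Then the entropy conservative volume contribution telescopes to the boundary entropy: ∑_{σ,θ=0}^{K} 2·Q_{σθ}·⟨W_σ, G(σ,θ)⟩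 = s_K − s₀. -/
open Matrix

/-- Given an SBP matrix `Q`, nodal vectors `U, W`, nodal scalars `s, Φ` with
`Φ_σ = ⟨W_σ, U_σ⟩ − s_σ`, and a symmetric, consistent two-point state `G` satisfying the
discrete entropy conservation condition, the entropy conservative volume contribution
telescopes to the boundary entropy: `∑ 2 Q_{σθ} ⟨W_σ, G(σ,θ)⟩ = s_K − s₀`. -/
theorem sbp_entropy_volume_telescopes (K p : ℕ) (hK : 1 ≤ K)
    (Q : Matrix (Fin (K + 1)) (Fin (K + 1)) ℝ) (hQ : IsSBP Q)
    (U W : Fin (K + 1) → (Fin p → ℝ)) (s Φ : Fin (K + 1) → ℝ)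
    (hΦ : ∀ σ, Φ σ = W σ ⬝ᵥ U σ - s σ)
    (G : Fin (K + 1) → Fin (K + 1) → (Fin p → ℝ))
    (hsym : ∀ σ θ, G σ θ = G θ σ)
    (hcons : ∀ σ, G σ σ = U σ)
    (hec : ∀ σ θ, (W σ - W θ) ⬝ᵥ G σ θ = Φ σ - Φ θ) :
    ∑ σ, ∑ θ, 2 * Q σ θ * (W σ ⬝ᵥ G σ θ) = s (Fin.last K) - s 0 := by
  obtain ⟨hrow, hB⟩ := hQ
  set b : Fin (K + 1) → ℝ :=
    fun i => if i = 0 then (-1 : ℝ) else if i = Fin.last K then 1 else 0 with hb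
  have hQB : ∀ σ θ, Q σ θ + Q θ σ = Matrix.diagonal b σ θ := by
    intro σ θ
    rw [← hB]
    simp
  have ha : ∀ σ θ, W σ ⬝ᵥ G σ θ - W θ ⬝ᵥ G θ σ = Φ σ - Φ θ := by
    intro σ θ
    rw [← hec σ θ, sub_dotProduct, hsym θ σ]
  have h0 : ∑ σ, ∑ θ, Q σ θ * Φ σ = 0 := by
    simp [← Finset.sum_mul, hrow]
  have h0' : ∑ σ, ∑ θ, Q θ σ * Φ θ = 0 := by
    rw [Finset.sum_comm]
    exact h0
  have hswap : ∑ σ, ∑ θ, Q θ σ * (W θ ⬝ᵥ G θ σ) = ∑ σ, ∑ θ, Q σ θ * (W σ ⬝ᵥ G σ θ) :=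
    Finset.sum_comm
  have hpt : ∀ σ θ, Q σ θ * (W σ ⬝ᵥ G σ θ) + Q θ σ * (W θ ⬝ᵥ G θ σ)
      = Q σ θ * Φ σ + Q θ σ * Φ θ + Matrix.diagonal b σ θ * (W θ ⬝ᵥ G θ σ - Φ θ) := by
    intro σ θ
    rw [← hQB]
    linear_combination Q σ θ * ha σ θ
  have hd : ∑ σ, ∑ θ, Matrix.diagonal b σ θ * (W θ ⬝ᵥ G θ σ - Φ θ) = ∑ σ, b σ * s σ := by
    refine Finset.sum_congr rfl fun σ _ => ?_
    rw [Finset.sum_eq_single σ]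
    · rw [Matrix.diagonal_apply_eq, hcons, hΦ]
      ring
    · intro θ _ h
      rw [Matrix.diagonal_apply_ne _ h.symm, zero_mul]
    · simp
  have hne : Fin.last K ≠ 0 := by
    intro h
    have := congrArg Fin.val h
    simp at this
    omega
  have hs : ∑ σ, b σ * s σ = s (Fin.last K) - s 0 := by
    have : ∀ σ, b σ * s σ = (if σ = Fin.last K then s σ else 0) - (if σ = 0 then s σ else 0) := by
      intro σ
      simp only [hb]
      by_cases h : σ = 0
      · subst h
        simp [hne.symm]
      · simp [h]
    simp only [this, Finset.sum_sub_distrib]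
    simp
  have hsum := Finset.sum_congr (rfl : (Finset.univ : Finset (Fin (K + 1))) = Finset.univ)
    fun σ _ => Finset.sum_congr (rfl : (Finset.univ : Finset (Fin (K + 1))) = Finset.univ)
      fun θ _ => hpt σ θ
  simp only [Finset.sum_add_distrib] at hsum
  rw [h0, h0', hswap, hd, hs] at hsum
  simp only [mul_assoc, ← Finset.mul_sum]
  linarith
end

section
/- Let K ≥ 1, let Q be a real (K+1)×(K+1) matrix (indices 0,…,K) with Q + Qᵀ = B, where B is the diagonal matrix with B₀₀ = −1, B_{KK} = 1 and all other entries 0, and let p ∈ ℕ. Let U, V : {0,…,K} → ℝᵖ be nodal vectors and let G : {0,…,K} × {0,…,K} → ℝᵖ be a two-point state that is symmetric (G(σ,θ) = G(θ,σ)), consistent (G(σ,σ) = U_σ), and satisfies ⟨V_σ − V_θ, G(σ,θ)⟩ = 0 for all σ, θ. Then the volume contribution telescopes to the boundary: ∑_{σ,θ=0}^{K} 2·Q_{σθ}·⟨V_σ, G(σ,θ)⟩ = ⟨V_K, U_K⟩ − ⟨V₀, U₀⟩. -/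
open Matrix

/-- Given a matrix `Q` with `Q + Qᵀ = B = diag(−1, 0, …, 0, 1)`, nodal vectors `U, V`, and a
symmetric, consistent two-point state `G` with `⟨V_σ − V_θ, G(σ,θ)⟩ = 0`, the volume
contribution telescopes to the boundary:
`∑ 2 Q_{σθ} ⟨V_σ, G(σ,θ)⟩ = ⟨V_K, U_K⟩ − ⟨V₀, U₀⟩`. -/
theorem sbp_kep_volume_telescopes (K p : ℕ) (hK : 1 ≤ K)
    (Q : Matrix (Fin (K + 1)) (Fin (K + 1)) ℝ)
    (hB : Q + Qᵀ = Matrix.diagonal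
      (fun i => if i = 0 then (-1 : ℝ) else if i = Fin.last K then 1 else 0))
    (U V : Fin (K + 1) → (Fin p → ℝ))
    (G : Fin (K + 1) → Fin (K + 1) → (Fin p → ℝ))
    (hsym : ∀ σ θ, G σ θ = G θ σ)
    (hcons : ∀ σ, G σ σ = U σ)
    (hkep : ∀ σ θ, (V σ - V θ) ⬝ᵥ G σ θ = 0) :
    ∑ σ, ∑ θ, 2 * Q σ θ * (V σ ⬝ᵥ G σ θ)
      = V (Fin.last K) ⬝ᵥ U (Fin.last K) - V 0 ⬝ᵥ U 0 := by
  have hs : ∀ σ θ, V θ ⬝ᵥ G θ σ = V σ ⬝ᵥ G σ θ := by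
    intro σ θ
    have h := hkep σ θ
    rw [sub_dotProduct] at h
    rw [hsym θ σ]
    linarith
  have h1 : ∑ σ, ∑ θ, 2 * Q σ θ * (V σ ⬝ᵥ G σ θ)
      = ∑ σ, ∑ θ, (Q + Qᵀ) σ θ * (V σ ⬝ᵥ G σ θ) := by
    have h2 : ∑ σ, ∑ θ, Q θ σ * (V σ ⬝ᵥ G σ θ) = ∑ σ, ∑ θ, Q σ θ * (V σ ⬝ᵥ G σ θ) := by
      rw [Finset.sum_comm]
      refine Finset.sum_congr rfl fun σ _ => Finset.sum_congr rfl fun θ _ => ?_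
      rw [hs σ θ]
    simp only [Matrix.add_apply, Matrix.transpose_apply, add_mul, Finset.sum_add_distrib, h2,
      mul_assoc, ← Finset.mul_sum]
    ring
  have hne : Fin.last K ≠ 0 := by
    intro h
    have := congrArg Fin.val h
    simp at this
    omega
  have h3 : ∀ σ, ∑ θ, (Q + Qᵀ) σ θ * (V σ ⬝ᵥ G σ θ)
      = (if σ = Fin.last K then V σ ⬝ᵥ U σ else 0) - (if σ = 0 then V σ ⬝ᵥ U σ else 0) := by
    intro σ
    rw [hB, Finset.sum_eq_single σ]
    · rw [Matrix.diagonal_apply_eq, hcons]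
      by_cases h0 : σ = 0
      · subst h0
        simp [hne.symm]
      · by_cases hl : σ = Fin.last K <;> simp [h0, hl, hne]
    · intro θ _ h
      rw [Matrix.diagonal_apply_ne _ h.symm, zero_mul]
    · simp
  rw [h1, Finset.sum_congr rfl fun σ _ => h3 σ, Finset.sum_sub_distrib]
  simp
end

section
/- Given two Euler states with velocities (v₁±, v₂±, v₃±) and pressures p±, let V± := (−½(v₁±² + v₂±² + v₃±²), v₁±, v₂±, v₃±, 0) ∈ ℝ⁵ and let F₁, F₂, F₃ ∈ ℝ⁵ be flux vectors whose momentum components satisfy Jameson's kinetic energy preservation conditions: F_l^{(1+k)} = {v_k}·F_l^{(1)} + δ_{kl}·{p} for all k, l ∈ {1,2,3} (where δ_{kl} is the Kronecker delta; the first components F_l^{(1)} and energy components F_l^{(5)} are arbitrary). Then for every ŝ ∈ ℝ and every n = (n₁, n₂, n₃) ∈ ℝ³, the surface contribution reduces to pressure work: ⟨V₊ − V₋, ŝ·(n₁F₁ + n₂F₂ + n₃F₃)⟩ = {p}·ŝ·(n₁⟦v₁⟧ + n₂⟦v₂⟧ + n₃⟦v₃⟧). -/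
open Matrix

/-- For flux vectors `F₁, F₂, F₃ ∈ ℝ⁵` whose momentum components satisfy Jameson's
kinetic energy preservation conditions `F_l^{(1+k)} = {v_k}·F_l^{(1)} + δ_{kl}·{p}`,
the surface contribution reduces to pressure work:
`⟨⟦V⟧, ŝ·(n₁F₁ + n₂F₂ + n₃F₃)⟩ = {p}·ŝ·(n₁⟦v₁⟧ + n₂⟦v₂⟧ + n₃⟦v₃⟧)`. -/
theorem jameson_kep_surface_pressure_work
    (v1m v2m v3m v1p v2p v3p pm pp shat n1 n2 n3 : ℝ)
    (F : Fin 3 → Fin 5 → ℝ)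
    (hF : ∀ k l : Fin 3,
      F l k.succ.castSucc =
        ((![v1p, v2p, v3p] k + ![v1m, v2m, v3m] k) / 2) * F l 0
          + (if k = l then (pp + pm) / 2 else 0)) :
    (![-(1 / 2) * (v1p ^ 2 + v2p ^ 2 + v3p ^ 2), v1p, v2p, v3p, 0] -
      ![-(1 / 2) * (v1m ^ 2 + v2m ^ 2 + v3m ^ 2), v1m, v2m, v3m, 0]) ⬝ᵥ
        (shat • (n1 • F 0 + n2 • F 1 + n3 • F 2))
      = ((pp + pm) / 2) * shat *
          (n1 * (v1p - v1m) + n2 * (v2p - v2m) + n3 * (v3p - v3m)) := by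
  have h1 : ∀ l, F l 1 = ((v1p + v1m) / 2) * F l 0 + (if (0 : Fin 3) = l then (pp + pm) / 2 else 0) :=
    fun l => hF 0 l
  have h2 : ∀ l, F l 2 = ((v2p + v2m) / 2) * F l 0 + (if (1 : Fin 3) = l then (pp + pm) / 2 else 0) :=
    fun l => hF 1 l
  have h3 : ∀ l, F l 3 = ((v3p + v3m) / 2) * F l 0 + (if (2 : Fin 3) = l then (pp + pm) / 2 else 0) :=
    fun l => hF 2 l
  clear hF
  have e1 : (-(1 / 2) * (v1p ^ 2 + v2p ^ 2 + v3p ^ 2) - -(1 / 2) * (v1m ^ 2 + v2m ^ 2 + v3m ^ 2)) * (shat * (n1 * F 0 0 + n2 * F 1 0 + n3 * F 2 0))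
      + (v1p - v1m) * (shat * (n1 * F 0 1 + n2 * F 1 1 + n3 * F 2 1))
      + (v2p - v2m) * (shat * (n1 * F 0 2 + n2 * F 1 2 + n3 * F 2 2))
      + (v3p - v3m) * (shat * (n1 * F 0 3 + n2 * F 1 3 + n3 * F 2 3))
      + (0 - 0) * (shat * (n1 * F 0 4 + n2 * F 1 4 + n3 * F 2 4))
      = ((pp + pm) / 2) * shat *
          (n1 * (v1p - v1m) + n2 * (v2p - v2m) + n3 * (v3p - v3m)) := by
    simp only [h1, h2, h3, Fin.reduceEq, if_true, if_false]
    ring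
  rw [← e1]
  simp only [dotProduct, Fin.sum_univ_five]
  rfl
end

section
/- Given two Euler states with velocities (v₁±, v₂±, v₃±) and pressures p±, metric values (a₁±, a₂±, a₃±) ∈ ℝ³, and real numbers p*₁, p*₂, p*₃ satisfying p*_s·{a_s} = 2{p}·{a_s} − {p·a_s} for s = 1, 2, 3, let V± := (−½(v₁±² + v₂±² + v₃±²), v₁±, v₂±, v₃±, 0) ∈ ℝ⁵ and let F₁, F₂, F₃ ∈ ℝ⁵ be flux vectors whose momentum components satisfy the curvilinear Jameson conditions F_s^{(1+k)} = {v_k}·F_s^{(1)} + δ_{ks}·p*_s for all k, s ∈ {1,2,3} (first components F_s^{(1)} and energy components F_s^{(5)} arbitrary). Then ⟨V₊ − V₋, ∑_{s=1}^{3} {a_s}·F_s⟩ = ∑_{s=1}^{3} ⟦v_s⟧·(2{p}·{a_s} − {p·a_s}), where {p·a_s} := (p₊·a_{s,+} + p₋·a_{s,−})/2. -/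
open Matrix

/-- Curvilinear version of Jameson's kinetic energy preservation: for fluxes `F₁, F₂, F₃`
whose momentum components satisfy `F_s^{(1+k)} = {v_k}·F_s^{(1)} + δ_{ks}·p*_s` with
`p*_s·{a_s} = 2{p}·{a_s} − {p·a_s}`, one has
`⟨⟦V⟧, ∑_s {a_s}·F_s⟩ = ∑_s ⟦v_s⟧·(2{p}·{a_s} − {p·a_s})`. -/
theorem jameson_kep_curvilinear_pressure_work
    (v1m v2m v3m v1p v2p v3p pm pp : ℝ)
    (am ap : Fin 3 → ℝ) (pstar : Fin 3 → ℝ)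
    (hpstar : ∀ s : Fin 3,
      pstar s * ((ap s + am s) / 2)
        = 2 * ((pp + pm) / 2) * ((ap s + am s) / 2) - (pp * ap s + pm * am s) / 2)
    (F : Fin 3 → Fin 5 → ℝ)
    (hF : ∀ k s : Fin 3,
      F s k.succ.castSucc =
        ((![v1p, v2p, v3p] k + ![v1m, v2m, v3m] k) / 2) * F s 0
          + (if k = s then pstar s else 0)) :
    (![-(1 / 2) * (v1p ^ 2 + v2p ^ 2 + v3p ^ 2), v1p, v2p, v3p, 0] -
      ![-(1 / 2) * (v1m ^ 2 + v2m ^ 2 + v3m ^ 2), v1m, v2m, v3m, 0]) ⬝ᵥ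
        (∑ s : Fin 3, ((ap s + am s) / 2) • F s)
      = ∑ s : Fin 3,
          (![v1p, v2p, v3p] s - ![v1m, v2m, v3m] s) *
            (2 * ((pp + pm) / 2) * ((ap s + am s) / 2) - (pp * ap s + pm * am s) / 2) := by
  simp_rw [← hpstar]
  have h1 : ∀ s, F s 1 = (v1p + v1m) / 2 * F s 0 + (if (0 : Fin 3) = s then pstar s else 0) :=
    fun s => hF 0 s
  have h2 : ∀ s, F s 2 = (v2p + v2m) / 2 * F s 0 + (if (1 : Fin 3) = s then pstar s else 0) :=
    fun s => hF 1 s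
  have h3 : ∀ s, F s 3 = (v3p + v3m) / 2 * F s 0 + (if (2 : Fin 3) = s then pstar s else 0) :=
    fun s => hF 2 s
  clear hF hpstar
  simp only [dotProduct, Fin.sum_univ_five, Fin.sum_univ_three, Pi.sub_apply, Pi.add_apply,
    Pi.smul_apply, smul_eq_mul, h1, h2, h3]
  simp
  ring
end
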